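/- Under the dual-system correspondence Φ̄ = Φ^{-1} (time-reversed indexing), C̄ matched in reverse order, Q̄_{N-k-1} = Φ_{k+1,k}^{-1} Q_k Φ_{k+1,k}^{-T}, and R̄ matched in reverse order, the noise-induced part of the stacked measurement covariance of the dual system in reverse-time order equals that of the original system in forward order: M̄ Q̄ M̄^T = M Q M^T, where M and M̄ are the respective block lower-triangular output-propagation matrices. -/

import Mathlib

open Matrix Finset

/-- `stm Φ j d` is the state transition matrix `Φ_{j+d, j}` built from the
one-step matrices `Φ k = Φ_{k+1,k}`. -/
def stm {n : ℕ} (Φ : ℕ → Matrix (Fin n) (Fin n) ℝ) (j : ℕ) : ℕ → Matrix (Fin n) (Fin n) ℝ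
  | 0 => 1
  | d + 1 => Φ (j + d) * stm Φ j d

/-- Forward block lower-triangular output-propagation matrix: block `(i,j)` is
`C_i Φ_{i,j+1}` for `j < i`, and `0` otherwise. -/
def Mmat {n p : ℕ} (Φ : ℕ → Matrix (Fin n) (Fin n) ℝ)
    (C : ℕ → Matrix (Fin p) (Fin n) ℝ) (m : ℕ) :
    Matrix (Fin (m + 1) × Fin p) (Fin m × Fin n) ℝ :=
  fun i j =>
    if (j.1 : ℕ) < (i.1 : ℕ) then
      (C (i.1 : ℕ) * stm Φ ((j.1 : ℕ) + 1) ((i.1 : ℕ) - ((j.1 : ℕ) + 1))) i.2 j.2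
    else 0

/-- Reverse-time block lower-triangular output-propagation matrix: block `(i,j)`
is `C_{N-i} Φ_{N-j,N-i}⁻¹` for `j < i`, and `0` otherwise. -/
noncomputable def Mcmat {n p : ℕ} (Φ : ℕ → Matrix (Fin n) (Fin n) ℝ)
    (C : ℕ → Matrix (Fin p) (Fin n) ℝ) (N : ℕ) :
    Matrix (Fin (N + 1) × Fin p) (Fin N × Fin n) ℝ :=
  fun i j =>
    if (j.1 : ℕ) < (i.1 : ℕ) then
      (C (N - (i.1 : ℕ)) * (stm Φ (N - (i.1 : ℕ)) ((i.1 : ℕ) - (j.1 : ℕ)))⁻¹) i.2 j.2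
    else 0

/-- Block diagonal process-noise covariance `blkdiag (Q 0, …, Q (m-1))`. -/
def blkQ {n : ℕ} (Q : ℕ → Matrix (Fin n) (Fin n) ℝ) (m : ℕ) :
    Matrix (Fin m × Fin n) (Fin m × Fin n) ℝ :=
  fun i j => if i.1 = j.1 then Q (i.1 : ℕ) i.2 j.2 else 0

/-- Reverse-ordered block diagonal `blkdiag (Q (N-1), …, Q 0)`. -/
def blkQrev {n : ℕ} (Q : ℕ → Matrix (Fin n) (Fin n) ℝ) (N : ℕ) :
    Matrix (Fin N × Fin n) (Fin N × Fin n) ℝ :=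
  fun i j => if i.1 = j.1 then Q (N - 1 - (i.1 : ℕ)) i.2 j.2 else 0

lemma stm_succ_eq_mul {n : ℕ} (Φ : ℕ → Matrix (Fin n) (Fin n) ℝ) (j d : ℕ) :
    stm Φ j (d + 1) = stm Φ (j + 1) d * Φ j := by
  induction d with
  | zero => simp [stm]
  | succ d ih =>
    rw [stm, ih, stm, Matrix.mul_assoc, show j + (d + 1) = j + 1 + d by omega]

lemma isUnit_det_stm {n : ℕ} {Φ : ℕ → Matrix (Fin n) (Fin n) ℝ}
    (hΦ : ∀ k, IsUnit (Φ k).det) (j d : ℕ) : IsUnit (stm Φ j d).det := by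
  induction d with
  | zero => simp [stm]
  | succ d ih =>
    rw [stm, det_mul]
    exact (hΦ _).mul ih

/-- The dual transition matrix is the inverse of the original one, in reversed time. -/
lemma stm_dual_eq_inv {n : ℕ} {Φ Φb : ℕ → Matrix (Fin n) (Fin n) ℝ} {N : ℕ}
    (hΦ : ∀ k, k < N → Φb (N - 1 - k) = (Φ k)⁻¹) {j d : ℕ} (h : j + d ≤ N) :
    stm Φb (N - (j + d)) d = (stm Φ j d)⁻¹ := by
  induction d generalizing j with
  | zero => simp [stm]
  | succ d ih =>
    have hd := ih (j := j + 1) (by omega)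
    rw [show j + 1 + d = j + (d + 1) by omega] at hd
    rw [stm, hd, show N - (j + (d + 1)) + d = N - 1 - j by omega, hΦ j (by omega),
      stm_succ_eq_mul, Matrix.mul_inv_rev]

lemma mul_blkQ_apply {ι : Type*} {n m : ℕ} (A : Matrix ι (Fin m × Fin n) ℝ)
    (Q : ℕ → Matrix (Fin n) (Fin n) ℝ) (i : ι) (j : Fin m × Fin n) :
    (A * blkQ Q m) i j = ∑ b, A i (j.1, b) * Q j.1 b j.2 := by
  simp only [Matrix.mul_apply, Fintype.sum_prod_type, blkQ, mul_ite, mul_zero]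
  rw [Finset.sum_comm]
  simp

lemma blkQ_mul {n m : ℕ} (A B : ℕ → Matrix (Fin n) (Fin n) ℝ) :
    blkQ A m * blkQ B m = blkQ (fun k => A k * B k) m := by
  ext i j
  rw [mul_blkQ_apply]
  by_cases h : i.1 = j.1 <;> simp [blkQ, h, Matrix.mul_apply]

lemma blkQ_transpose {n m : ℕ} (A : ℕ → Matrix (Fin n) (Fin n) ℝ) :
    (blkQ A m)ᵀ = blkQ (fun k => (A k)ᵀ) m := by
  ext i j
  by_cases h : i.1 = j.1
  · simp [blkQ, h]
  · simp [blkQ, h, Ne.symm h]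

/-- The dual propagation matrix is the original one times `blkdiag (Φ 0, …, Φ (N-1))`. -/
lemma Mcmat_dual_eq {n p : ℕ} {Φ Φb : ℕ → Matrix (Fin n) (Fin n) ℝ}
    {C Cb : ℕ → Matrix (Fin p) (Fin n) ℝ} {N : ℕ}
    (hΦinv : ∀ k, IsUnit (Φ k).det)
    (hΦ : ∀ k, k < N → Φb (N - 1 - k) = (Φ k)⁻¹)
    (hC : ∀ k, k ≤ N → Cb (N - k) = C k) :
    Mcmat Φb Cb N = Mmat Φ C N * blkQ Φ N := by
  ext ⟨i, a⟩ ⟨j, b⟩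
  rw [mul_blkQ_apply]
  by_cases h : (j : ℕ) < i
  · obtain ⟨d, hd⟩ : ∃ d, (i : ℕ) = j + (d + 1) := ⟨i - j - 1, by omega⟩
    have hs := stm_dual_eq_inv hΦ (j := j) (d := d + 1) (by omega)
    simp only [Mcmat, Mmat, h, if_true]
    rw [hC i (by omega), show (i : ℕ) - j = d + 1 by omega,
      show (i : ℕ) - (j + 1) = d by omega, show N - (i : ℕ) = N - (j + (d + 1)) by omega, hs,
      Matrix.nonsing_inv_nonsing_inv _ (isUnit_det_stm hΦinv _ _), stm_succ_eq_mul,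
      ← Matrix.mul_assoc, Matrix.mul_apply]
  · simp [Mcmat, Mmat, h]

lemma blkQrev_dual_eq {n : ℕ} {Φ Q Qb : ℕ → Matrix (Fin n) (Fin n) ℝ} {N : ℕ}
    (hQ : ∀ k, k < N → Qb (N - 1 - k) = (Φ k)⁻¹ * Q k * ((Φ k)⁻¹)ᵀ) :
    blkQrev Qb N = blkQ (fun k => (Φ k)⁻¹ * Q k * ((Φ k)⁻¹)ᵀ) N := by
  ext i j
  simp only [blkQrev, blkQ, hQ _ i.1.isLt]

/-- Under the dual-system correspondence
`Φ̄_{N-k,N-k-1} = Φ_{k+1,k}⁻¹`, `C̄_{N-k} = C_k`,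
`Q̄_{N-k-1} = Φ_{k+1,k}⁻¹ Q_k Φ_{k+1,k}⁻ᵀ`, the noise-induced part of the
stacked measurement covariance of the dual system in reverse-time order equals
that of the original system in forward order: `M̄ Q̄ M̄ᵀ = M Q Mᵀ`. -/
theorem dual_noise_covariance_eq
    {n p : ℕ} (Φ Φb : ℕ → Matrix (Fin n) (Fin n) ℝ)
    (C Cb : ℕ → Matrix (Fin p) (Fin n) ℝ)
    (Q Qb : ℕ → Matrix (Fin n) (Fin n) ℝ) (N : ℕ)
    (hΦinv : ∀ k, IsUnit (Φ k).det)
    (hQpos : ∀ k, (Q k).PosDef)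
    (hΦ : ∀ k, k < N → Φb (N - 1 - k) = (Φ k)⁻¹)
    (hC : ∀ k, k ≤ N → Cb (N - k) = C k)
    (hQ : ∀ k, k < N → Qb (N - 1 - k) = (Φ k)⁻¹ * Q k * ((Φ k)⁻¹)ᵀ) :
    Mcmat Φb Cb N * blkQrev Qb N * (Mcmat Φb Cb N)ᵀ =
      Mmat Φ C N * blkQ Q N * (Mmat Φ C N)ᵀ := by
  have hcancel : ∀ k, Φ k * ((Φ k)⁻¹ * Q k * ((Φ k)⁻¹)ᵀ) * (Φ k)ᵀ = Q k := fun k => by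
    rw [Matrix.mul_assoc, Matrix.mul_assoc, ← Matrix.transpose_mul,
      Matrix.mul_nonsing_inv _ (hΦinv k), Matrix.transpose_one, Matrix.mul_one,
      Matrix.mul_nonsing_inv_cancel_left _ _ (hΦinv k)]
  have hblk : blkQ Φ N * blkQrev Qb N * (blkQ Φ N)ᵀ = blkQ Q N := by
    simp only [blkQrev_dual_eq hQ, blkQ_transpose, blkQ_mul, hcancel]
  rw [Mcmat_dual_eq hΦinv hΦ hC, Matrix.transpose_mul, ← hblk]
  simp only [Matrix.mul_assoc]
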